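/- Fix a probability measure D on Z, integers m, n ≥ 1, a prior probability measure P on H, and δ, δ' ∈ (0,1) with δ + δ' < 1. Let S ↦ Q_S be a Markov kernel from Z^m to probability measures on H (a data-dependent posterior), and given S let W_1,…,W_n be drawn i.i.d. from Q_S. Then with probability at least 1 − δ − δ' over the joint draw of S ~ D^⊗m and W_1,…,W_n, R_D(Q_S) ≤ kl⁻¹( kl⁻¹( (1/n)∑_{i=1}^n R̂_S(W_i), (1/n) ln(2/δ') ), (KL(Q_S‖P) + ln(2√m/δ)) / m ). -/

import Mathlib

open MeasureTheory ENNReal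

/-- Binary Kullback–Leibler divergence `kl(q,p)` for `q, p ∈ [0,1]`, with the conventions
`0 · ln 0 = 0` and `kl(q,p) = ∞` when `p ∈ {0,1}` and `q ≠ p`. -/
noncomputable def klBin (q p : ℝ) : ℝ≥0∞ :=
  if (p = 0 ∨ p = 1) ∧ q ≠ p then ∞
  else ENNReal.ofReal (q * Real.log (q / p) + (1 - q) * Real.log ((1 - q) / (1 - p)))

open Classical in
/-- Kullback–Leibler divergence between measures, `+∞` if `Q` is not absolutely
continuous with respect to `P` (or if the log-likelihood ratio is not integrable,
in which case the divergence between probability measures is indeed infinite). -/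
noncomputable def klDiv' {α : Type*} [MeasurableSpace α] (Q P : Measure α) : ℝ≥0∞ :=
  if Q ≪ P ∧ Integrable (fun x => Real.log (Q.rnDeriv P x).toReal) Q
  then ENNReal.ofReal (∫ x, Real.log (Q.rnDeriv P x).toReal ∂Q)
  else ∞

/-- Inverse binary KL divergence: `kl⁻¹(x,b) = sup { y ∈ [x,1] : kl(x,y) ≤ b }`. -/
noncomputable def klInv (x : ℝ) (b : ℝ≥0∞) : ℝ :=
  sSup {y : ℝ | x ≤ y ∧ y ≤ 1 ∧ klBin x y ≤ b}

/-- Population risk of a hypothesis `h`. -/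
noncomputable def riskD {H Z : Type*} [MeasurableSpace Z] (ℓ : H → Z → ℝ)
    (D : Measure Z) (h : H) : ℝ := ∫ z, ℓ h z ∂D

/-- Empirical risk of a hypothesis `h` on the sample `S`. -/
noncomputable def riskS {H Z : Type*} (ℓ : H → Z → ℝ) {m : ℕ} (S : Fin m → Z) (h : H) : ℝ :=
  (1 / (m : ℝ)) * ∑ j, ℓ h (S j)

/-- Population risk of a distribution `Q` over hypotheses. -/
noncomputable def riskDQ {H Z : Type*} [MeasurableSpace H] [MeasurableSpace Z]
    (ℓ : H → Z → ℝ) (D : Measure Z) (Q : Measure H) : ℝ := ∫ h, riskD ℓ D h ∂Q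

/-- Empirical risk of a distribution `Q` over hypotheses on the sample `S`. -/
noncomputable def riskSQ {H Z : Type*} [MeasurableSpace H] (ℓ : H → Z → ℝ) {m : ℕ}
    (S : Fin m → Z) (Q : Measure H) : ℝ := ∫ h, riskS ℓ S h ∂Q

/-- Krichevsky–Trofimov probability of a binary word with `a` ones and `b` zeros. -/
noncomputable def ktProb (a b : ℕ) : ℝ :=
  (∏ i ∈ Finset.range a, ((i : ℝ) + 1 / 2)) * (∏ i ∈ Finset.range b, ((i : ℝ) + 1 / 2)) /
    (a + b).factorial

/-- Maximal Bernoulli likelihood of a binary word with `a` ones and `b` zeros. -/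
noncomputable def maxLik (a b : ℕ) : ℝ :=
  (a : ℝ) ^ a * (b : ℝ) ^ b / ((a : ℝ) + b) ^ (a + b)

lemma ktProb_comm (a b : ℕ) : ktProb a b = ktProb b a := by
  rw [ktProb, ktProb, mul_comm, add_comm a b]

lemma maxLik_comm (a b : ℕ) : maxLik a b = maxLik b a := by
  rw [maxLik, maxLik, mul_comm, add_comm a b, add_comm (a : ℝ) b]

lemma ktProb_succ_left (a b : ℕ) :
    ktProb (a + 1) b = ktProb a b * ((a + 1 / 2) / (a + b + 1)) := by
  have h : a + 1 + b = (a + b) + 1 := by ring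
  have h2 : ((a + b).factorial : ℝ) ≠ 0 := by positivity
  have h3 : (a : ℝ) + b + 1 ≠ 0 := by positivity
  rw [ktProb, ktProb, Finset.prod_range_succ, h, Nat.factorial_succ]
  generalize ∏ i ∈ Finset.range a, ((i : ℝ) + 1 / 2) = A
  generalize ∏ i ∈ Finset.range b, ((i : ℝ) + 1 / 2) = B
  push_cast
  field_simp

lemma ktProb_succ_add (a b : ℕ) : ktProb (a + 1) b + ktProb a (b + 1) = ktProb a b := by
  rw [ktProb_comm a (b + 1), ktProb_succ_left, ktProb_succ_left, ktProb_comm b a]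
  have h3 : (a : ℝ) + b + 1 ≠ 0 := by positivity
  have h4 : (b : ℝ) + a + 1 ≠ 0 := by positivity
  field_simp
  ring

lemma sum_choose_mul_ktProb (n : ℕ) :
    ∑ k ∈ Finset.range (n + 1), (n.choose k : ℝ) * ktProb k (n - k) = 1 := by
  rw [← Finset.Nat.sum_antidiagonal_eq_sum_range_succ
    (fun i j => (n.choose i : ℝ) * ktProb i j) n]
  induction n with
  | zero => simp [ktProb]
  | succ n ih =>
    rw [Finset.sum_antidiagonal_choose_succ_mul (fun i j => ktProb i j) n,
      ← Finset.sum_add_distrib, ← ih]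
    refine Finset.sum_congr rfl fun ij hij => ?_
    have := Finset.HasAntidiagonal.mem_antidiagonal.1 hij
    have hc : n.choose ij.2 = n.choose ij.1 := by
      rw [← this]; exact Nat.choose_symm_add.symm
    rw [hc, ← mul_add, add_comm, ktProb_succ_add]

lemma log_le_sub_inv_sqrt {y : ℝ} (hy : 1 ≤ y) : Real.log y ≤ (y - 1) / √y := by
  have hs : 1 ≤ √y := Real.one_le_sqrt.2 hy
  have h0 : 0 < √y := by linarith
  have h := Real.self_le_sinh_iff.2 (Real.log_nonneg hs)
  rw [Real.sinh_log h0, Real.log_sqrt (by linarith)] at h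
  have h2 : √y * √y = y := Real.mul_self_sqrt (by linarith)
  have : (y - 1) / √y = √y - (√y)⁻¹ := by
    field_simp; nlinarith
  rw [this]; linarith

lemma succ_pow_succ_le (a : ℕ) :
    ((a : ℝ) + 1) ^ (a + 1) ≤ Real.exp 1 * (a + 1 / 2) * (a : ℝ) ^ a := by
  rcases Nat.eq_zero_or_pos a with rfl | ha
  · have := Real.add_one_le_exp 1
    norm_num; linarith
  have ha' : (0 : ℝ) < a := by exact_mod_cast ha
  have hlog : (a + 1) * Real.log (a + 1) ≤ 1 + Real.log (a + 1 / 2) + a * Real.log a := by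
    have h1 := log_le_sub_inv_sqrt (y := ((a : ℝ) + 1) / a) (by rw [le_div_iff₀ ha']; linarith)
    have h2 := log_le_sub_inv_sqrt (y := ((a : ℝ) + 1) / (a + 1 / 2))
      (by rw [le_div_iff₀ (by positivity)]; linarith)
    rw [Real.log_div (by positivity) (by positivity), Real.sqrt_div (by positivity)] at h1 h2
    set u := √(a : ℝ)
    set v := √((a : ℝ) + 1)
    set w := √((a : ℝ) + 1 / 2)
    have hu : u * u = a := Real.mul_self_sqrt (by positivity)
    have hv : v * v = a + 1 := Real.mul_self_sqrt (by positivity)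
    have hw : w * w = a + 1 / 2 := Real.mul_self_sqrt (by positivity)
    have hu0 : 0 < u := Real.sqrt_pos.2 (by positivity)
    have hv0 : 0 < v := Real.sqrt_pos.2 (by positivity)
    have hw0 : 0 < w := Real.sqrt_pos.2 (by positivity)
    have e1 : (((a : ℝ) + 1) / a - 1) / (v / u) = 1 / (u * v) := by
      rw [← hu]; field_simp; ring
    have e2 : (((a : ℝ) + 1) / (a + 1 / 2) - 1) / (v / w) = 1 / (2 * w * v) := by
      rw [← hw]; field_simp; nlinarith
    rw [e1] at h1
    rw [e2] at h2
    have h3 : a * (1 / (u * v)) = u / v := by rw [← hu]; field_simp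
    have h4 : u / v + 1 / (2 * w * v) ≤ 1 := by
      have : u / v + 1 / (2 * w * v) = (2 * w * u + 1) / (2 * w * v) := by field_simp
      rw [this, div_le_one (by positivity)]
      have h5 : u + v ≤ 2 * w := by
        apply le_of_sq_le_sq _ (by positivity)
        nlinarith [sq_nonneg (u - v)]
      have h6 : u ≤ v := Real.sqrt_le_sqrt (by linarith)
      nlinarith
    have h7 := mul_le_mul_of_nonneg_left h1 ha'.le
    rw [h3] at h7
    linarith
  rw [← Real.log_le_log_iff (by positivity) (by positivity),
    Real.log_mul (by positivity) (by positivity), Real.log_mul (by positivity) (by positivity),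
    Real.log_exp, Real.log_pow, Real.log_pow]
  push_cast
  exact hlog

lemma exp_one_mul_pow_le {n : ℕ} (hn : 1 ≤ n) :
    Real.exp 1 * (n : ℝ) ^ n * √n ≤ ((n : ℝ) + 1) ^ n * √(n + 1) := by
  have hn' : (0 : ℝ) < n := by exact_mod_cast hn
  have h := Real.le_log_one_add_of_nonneg (x := 1 / (n : ℝ)) (by positivity)
  have e : 1 + 1 / (n : ℝ) = (n + 1) / n := by field_simp
  have e2 : 2 * (1 / (n : ℝ)) / (1 / n + 2) = 1 / (n + 1 / 2) := by field_simp; ring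
  rw [e, e2, Real.log_div (by positivity) (by positivity), div_le_iff₀ (by positivity)] at h
  rw [← Real.log_le_log_iff (by positivity) (by positivity),
    Real.log_mul (by positivity) (by positivity), Real.log_mul (by positivity) (by positivity),
    Real.log_mul (by positivity) (by positivity),
    Real.log_exp, Real.log_pow, Real.log_pow, Real.log_sqrt (by positivity),
    Real.log_sqrt (by positivity)]
  linarith

lemma maxLik_succ_left {a b : ℕ} (hab : 1 ≤ a + b)
    (h : maxLik a b ≤ 2 * √(a + b) * ktProb a b) :
    maxLik (a + 1) b ≤ 2 * √((a + 1 : ℕ) + b) * ktProb (a + 1) b := by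
  have hn : (0 : ℝ) < a + b := by exact_mod_cast hab
  have h1 := succ_pow_succ_le a
  have h2 := exp_one_mul_pow_le hab
  push_cast at h2 ⊢
  rw [ktProb_succ_left]
  have hpa : 0 < (a : ℝ) ^ a := by
    rcases Nat.eq_zero_or_pos a with rfl | ha
    · simp
    · positivity
  have hcast : (a : ℝ) + 1 + b = a + b + 1 := by ring
  have key : maxLik (a + 1) b * √(a + b) ≤
      maxLik a b * (√(a + b + 1) * ((a + 1 / 2) / (a + b + 1))) := by
    have e0 : a + 1 + b = a + b + 1 := by ring
    unfold maxLik
    rw [e0, div_mul_eq_mul_div, div_mul_eq_mul_div, div_le_div_iff₀ (by positivity) (by positivity)]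
    push_cast
    rw [hcast]
    have e1 : (a : ℝ) ^ a * (b : ℝ) ^ b * (√(a + b + 1) * ((a + 1 / 2) / (a + b + 1))) *
        (a + b + 1) ^ (a + b + 1) =
        (a : ℝ) ^ a * (b : ℝ) ^ b * (√(a + b + 1) * (a + 1 / 2)) * (a + b + 1) ^ (a + b) := by
      rw [pow_succ]; field_simp
    rw [e1]
    have hm := mul_le_mul h1 h2 (by positivity) (by positivity)
    have hpb : 0 ≤ (b : ℝ) ^ b := by positivity
    have hm2 : ((a : ℝ) + 1) ^ (a + 1) * ((a + b) ^ (a + b) * √(a + b)) ≤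
        (a + 1 / 2) * a ^ a * ((a + b + 1) ^ (a + b) * √(a + b + 1)) := by
      have he := Real.exp_pos 1
      refine le_of_mul_le_mul_left ?_ he
      calc _ = _ := ?_
        _ ≤ _ := hm
        _ = _ := ?_
      · ring
      · ring
    calc _ = (b : ℝ) ^ b * (((a : ℝ) + 1) ^ (a + 1) * ((a + b) ^ (a + b) * √(a + b))) := by ring
      _ ≤ _ := mul_le_mul_of_nonneg_left hm2 hpb
      _ = _ := by ring
  have hs : 0 < √((a : ℝ) + b) := Real.sqrt_pos.2 hn
  refine le_of_mul_le_mul_right ?_ hs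
  rw [hcast]
  calc _ ≤ _ := key
    _ ≤ _ := mul_le_mul_of_nonneg_right h (by positivity)
    _ = _ := by ring

lemma maxLik_le {a b : ℕ} (hab : 1 ≤ a + b) :
    maxLik a b ≤ 2 * √(a + b) * ktProb a b := by
  have hb0 : ∀ c : ℕ, maxLik (c + 1) 0 ≤ 2 * √((c + 1 : ℕ) + (0 : ℕ)) * ktProb (c + 1) 0 := by
    intro c
    induction c with
    | zero => norm_num [maxLik, ktProb]
    | succ c ih => exact maxLik_succ_left (by omega) ih
  rcases b with _ | b
  · obtain ⟨c, rfl⟩ : ∃ c, a = c + 1 := ⟨a - 1, by omega⟩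
    exact hb0 c
  · clear hab
    induction a with
    | zero => rw [maxLik_comm, ktProb_comm, add_comm ((0 : ℕ) : ℝ)]; exact hb0 b
    | succ a ih => exact maxLik_succ_left (by omega) ih

lemma sum_choose_mul_maxLik_le {n : ℕ} (hn : 1 ≤ n) :
    ∑ k ∈ Finset.range (n + 1), (n.choose k : ℝ) * maxLik k (n - k) ≤ 2 * √n := by
  rw [← mul_one (2 * √(n : ℝ)), ← sum_choose_mul_ktProb n, Finset.mul_sum]
  refine Finset.sum_le_sum fun k hk => ?_
  have hk' : k + (n - k) = n := by have := Finset.mem_range.1 hk; omega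
  have h := maxLik_le (a := k) (b := n - k) (by omega)
  rw [← Nat.cast_add, hk'] at h
  calc _ ≤ (n.choose k : ℝ) * (2 * √n * ktProb k (n - k)) := by gcongr
    _ = _ := by ring

/-- Real-valued binary Kullback–Leibler divergence, meaningful for `p ∈ (0,1)`. -/
noncomputable def binKL (q p : ℝ) : ℝ :=
  q * Real.log (q / p) + (1 - q) * Real.log ((1 - q) / (1 - p))

lemma klBin_eq_ofReal {q p : ℝ} (h0 : 0 < p) (h1 : p < 1) :
    klBin q p = ENNReal.ofReal (binKL q p) := by
  rw [klBin, if_neg (by rintro ⟨h | h, -⟩ <;> linarith), binKL]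

lemma klBin_self (p : ℝ) : klBin p p = 0 := by
  rw [klBin, if_neg (fun h => h.2 rfl), ENNReal.ofReal_eq_zero]
  rcases eq_or_ne p 0 with rfl | h
  · simp
  rcases eq_or_ne (1 - p) 0 with h' | h'
  · simp [h', div_self h]
  · simp [div_self h, div_self h']

lemma binKL_eq {p : ℝ} (h0 : 0 < p) (h1 : p < 1) (q : ℝ) :
    binKL q p = q * Real.log q + (1 - q) * Real.log (1 - q) -
      (q * Real.log p + (1 - q) * Real.log (1 - p)) := by
  have key : ∀ a c : ℝ, 0 < c → a * Real.log (a / c) = a * Real.log a - a * Real.log c := by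
    intro a c hc
    rcases eq_or_ne a 0 with rfl | ha
    · simp
    · rw [Real.log_div ha hc.ne']; ring
  rw [binKL, key q p h0, key (1 - q) (1 - p) (by linarith)]
  ring

lemma measurable_binKL : Measurable fun x : ℝ × ℝ => binKL x.1 x.2 := by
  unfold binKL
  fun_prop

lemma continuous_binKL {p : ℝ} (h0 : 0 < p) (h1 : p < 1) : Continuous fun q => binKL q p := by
  simp_rw [binKL_eq h0 h1]
  have h := Real.continuous_mul_log
  have h' : Continuous fun q : ℝ => (1 - q) * Real.log (1 - q) :=
    h.comp (continuous_const.sub continuous_id)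
  fun_prop

lemma convexOn_binKL {p : ℝ} (h0 : 0 < p) (h1 : p < 1) :
    ConvexOn ℝ (Set.Icc 0 1) fun q => binKL q p := by
  have hf : ConvexOn ℝ (Set.Icc (0 : ℝ) 1) fun q => q * Real.log q :=
    Real.convexOn_mul_log.subset (fun x hx => hx.1) (convex_Icc 0 1)
  refine ⟨convex_Icc 0 1, fun x hx y hy a b ha hb hab => ?_⟩
  have h2 := hf.2 hx hy ha hb hab
  have h3 := hf.2 (x := 1 - x) ⟨by linarith [hx.2], by linarith [hx.1]⟩
    (y := 1 - y) ⟨by linarith [hy.2], by linarith [hy.1]⟩ ha hb hab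
  simp only [smul_eq_mul, binKL_eq h0 h1] at h2 h3 ⊢
  have e : 1 - (a * x + b * y) = a * (1 - x) + b * (1 - y) := by linear_combination -hab
  rw [e]
  linarith

/-- Tangent-line lower bound for the perspective of `x ↦ x log x`. -/
lemma mul_log_div_ge {x y c : ℝ} (hx : 0 ≤ x) (hy : 0 ≤ y) (hc : 0 < c) (hxy : y = 0 → x = 0) :
    x * Real.log c + x - y * c ≤ x * Real.log (x / y) := by
  rcases hx.eq_or_lt with rfl | hx
  · simp; positivity
  have hy : 0 < y := hy.lt_of_ne fun h => hx.ne' (hxy h.symm)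
  have h := Real.one_sub_inv_le_log_of_pos (x := x / y / c) (by positivity)
  rw [Real.log_div (by positivity) hc.ne'] at h
  have e : x * (1 - (x / y / c)⁻¹) = x - y * c := by field_simp
  have := mul_le_mul_of_nonneg_left h hx.le
  rw [e] at this
  linarith

lemma binKL_nonneg {q p : ℝ} (hq0 : 0 ≤ q) (hq1 : q ≤ 1) (hp0 : 0 ≤ p) (hp1 : p ≤ 1)
    (h0 : p = 0 → q = 0) (h1 : p = 1 → q = 1) : 0 ≤ binKL q p := by
  have e0 := mul_log_div_ge hq0 hp0 one_pos h0
  have e1 := mul_log_div_ge (x := 1 - q) (y := 1 - p) (by linarith) (by linarith) one_pos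
    (fun h => by linarith [h1 (by linarith)])
  simp only [Real.log_one] at e0 e1
  unfold binKL
  linarith

lemma binKL_self {p : ℝ} (h0 : 0 < p) (h1 : p < 1) : binKL p p = 0 := by
  rw [binKL_eq h0 h1]; ring

lemma binKL_anti {x x' y : ℝ} (hx : 0 ≤ x) (hxx' : x ≤ x') (hx'y : x' ≤ y) (h0 : 0 < y)
    (h1 : y < 1) : binKL x' y ≤ binKL x y := by
  rcases hxx'.eq_or_lt with rfl | hlt
  · rfl
  have hd : 0 < y - x := by linarith
  have hx1 : x ∈ Set.Icc (0 : ℝ) 1 := ⟨hx, by linarith⟩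
  have hy1 : y ∈ Set.Icc (0 : ℝ) 1 := ⟨h0.le, h1.le⟩
  have h := (convexOn_binKL h0 h1).2 hx1 hy1
    (div_nonneg (by linarith : 0 ≤ y - x') hd.le) (div_nonneg (by linarith : 0 ≤ x' - x) hd.le)
    (by field_simp; ring)
  have e : (y - x') / (y - x) * x + (x' - x) / (y - x) * y = x' := by field_simp; ring
  have hn := binKL_nonneg hx (by linarith : x ≤ 1) h0.le h1.le (fun h => by linarith)
    (fun h => by linarith)
  simp only [smul_eq_mul, e, binKL_self h0 h1, mul_zero, add_zero] at h
  refine h.trans (mul_le_of_le_one_left hn ?_)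
  rw [div_le_one hd]; linarith

lemma bddAbove_klInv (x : ℝ) (b : ℝ≥0∞) : BddAbove {y : ℝ | x ≤ y ∧ y ≤ 1 ∧ klBin x y ≤ b} :=
  ⟨1, fun _ hy => hy.2.1⟩

lemma self_le_klInv {x : ℝ} (hx : x ≤ 1) (b : ℝ≥0∞) : x ≤ klInv x b :=
  le_csSup (bddAbove_klInv x b) ⟨le_rfl, hx, by simp [klBin_self]⟩

lemma klInv_le_one {x : ℝ} (hx : x ≤ 1) (b : ℝ≥0∞) : klInv x b ≤ 1 :=
  csSup_le ⟨x, le_rfl, hx, by simp [klBin_self]⟩ fun _ hy => hy.2.1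

lemma one_le_klInv_top {x : ℝ} (hx : x ≤ 1) : 1 ≤ klInv x ∞ :=
  le_csSup (bddAbove_klInv x ∞) ⟨hx, le_rfl, le_top⟩

lemma le_klInv {x y : ℝ} {b : ℝ≥0∞} (hx0 : 0 ≤ x) (hx1 : x ≤ 1)
    (h : y ≤ x ∨ y < 1 ∧ ENNReal.ofReal (binKL x y) ≤ b) : y ≤ klInv x b := by
  rcases le_or_gt y x with hyx | hxy
  · exact hyx.trans (self_le_klInv hx1 b)
  · obtain ⟨hy1, hb⟩ := h.resolve_left hxy.not_ge
    refine le_csSup (bddAbove_klInv x b) ⟨hxy.le, hy1.le, ?_⟩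
    rwa [klBin_eq_ofReal (by linarith) hy1]

lemma klInv_mono {x x' : ℝ} (b : ℝ≥0∞) (hx : 0 ≤ x) (hxx' : x ≤ x') (hx' : x' ≤ 1) :
    klInv x b ≤ klInv x' b := by
  refine csSup_le ⟨x, le_rfl, hxx'.trans hx', by simp [klBin_self]⟩ ?_
  rintro y ⟨hxy, hy1, hb⟩
  rcases le_or_gt y x' with hyx | hxy'
  · exact hyx.trans (self_le_klInv hx' b)
  rcases hy1.eq_or_lt with rfl | hy1
  · rw [klBin, if_pos ⟨Or.inr rfl, by linarith⟩, top_le_iff] at hb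
    exact hb ▸ one_le_klInv_top hx'
  · have hy0 : 0 < y := by linarith
    rw [klBin_eq_ofReal hy0 hy1] at hb
    exact le_klInv (hx.trans hxx') hx' (Or.inr ⟨hy1,
      (ENNReal.ofReal_le_ofReal (binKL_anti hx hxx' hxy'.le hy0 hy1)).trans hb⟩)

lemma exp_mul_binKL_eq {k m : ℕ} (hm : 1 ≤ m) (hk : k ≤ m) {p : ℝ} (h0 : 0 < p) (h1 : p < 1) :
    Real.exp (m * binKL (k / m) p) * (p ^ k * (1 - p) ^ (m - k)) = maxLik k (m - k) := by
  obtain ⟨l, rfl⟩ := Nat.exists_eq_add_of_le hk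
  have hm0 : (0 : ℝ) < ((k + l : ℕ) : ℝ) := by exact_mod_cast hm
  have h1' : 0 < 1 - p := by linarith
  have key : ∀ (c : ℕ) (r : ℝ), 0 < r →
      Real.exp (c * Real.log (c / ((k + l : ℕ) : ℝ) / r)) = (c / ((k + l : ℕ) : ℝ) / r) ^ c := by
    intro c r hr
    rcases Nat.eq_zero_or_pos c with rfl | hc
    · simp
    · have : (0 : ℝ) < c := by exact_mod_cast hc
      rw [Real.exp_nat_mul, Real.exp_log (by positivity)]
  have e : (1 : ℝ) - k / ((k + l : ℕ) : ℝ) = l / ((k + l : ℕ) : ℝ) := by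
    field_simp; push_cast; ring
  have e2 : ((k + l : ℕ) : ℝ) * binKL (k / ((k + l : ℕ) : ℝ)) p =
      k * Real.log (k / ((k + l : ℕ) : ℝ) / p) +
        l * Real.log (l / ((k + l : ℕ) : ℝ) / (1 - p)) := by
    rw [binKL, e]; field_simp
  rw [e2, Real.exp_add, key k p h0, key l (1 - p) h1', Nat.add_sub_cancel_left, maxLik,
    ← Nat.cast_add]
  simp only [div_pow]
  rw [pow_add]
  field_simp

/-- Averages of `[0,1]`-valued tuples are dominated by Bernoulli tuples for convex functions. -/
lemma convexOn_average_le_sum_powerset {m : ℕ} (hm : 1 ≤ m) {f : ℝ → ℝ}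
    (hf : ConvexOn ℝ (Set.Icc 0 1) f) (x : Fin m → ℝ) (hx : ∀ i, x i ∈ Set.Icc (0 : ℝ) 1) :
    f ((1 / (m : ℝ)) * ∑ i, x i) ≤
      ∑ s : Finset (Fin m), (∏ i, if i ∈ s then x i else 1 - x i) * f (s.card / m) := by
  have hm0 : (0 : ℝ) < m := by exact_mod_cast hm
  have hprod : ∀ g h : Fin m → ℝ,
      ∑ s : Finset (Fin m), (∏ i, if i ∈ s then g i else h i) = ∏ i, (g i + h i) := by
    intro g h
    rw [Fintype.prod_add]
    refine Finset.sum_congr rfl fun s _ => ?_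
    rw [← Finset.prod_mul_prod_compl s]
    congr 1
    · exact Finset.prod_congr rfl fun i hi => if_pos hi
    · exact Finset.prod_congr rfl fun i hi => if_neg (Finset.mem_compl.1 hi)
  have hw0 : ∀ s ∈ (Finset.univ : Finset (Finset (Fin m))),
      0 ≤ ∏ i, if i ∈ s then x i else 1 - x i := fun s _ => Finset.prod_nonneg fun i _ => by
    split_ifs
    · exact (hx i).1
    · linarith [(hx i).2]
  have hw1 : ∑ s : Finset (Fin m), (∏ i, if i ∈ s then x i else 1 - x i) = 1 := by
    rw [hprod]; simp
  have hmem : ∀ s ∈ (Finset.univ : Finset (Finset (Fin m))),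
      (s.card : ℝ) / m ∈ Set.Icc (0 : ℝ) 1 := fun s _ => by
    refine ⟨by positivity, ?_⟩
    rw [div_le_one hm0]
    exact_mod_cast s.card_le_univ.trans (by simp)
  have h := hf.map_sum_le hw0 hw1 hmem
  simp only [smul_eq_mul] at h
  have hmarg : ∀ j, ∑ s : Finset (Fin m),
      (∏ i, if i ∈ s then x i else 1 - x i) * (if j ∈ s then (1 : ℝ) else 0) = x j := by
    intro j
    have : ∀ s : Finset (Fin m),
        (∏ i, if i ∈ s then x i else 1 - x i) * (if j ∈ s then (1 : ℝ) else 0) =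
        ∏ i, if i ∈ s then x i else (if i = j then 0 else 1 - x i) := by
      intro s
      by_cases hj : j ∈ s
      · rw [if_pos hj, mul_one]
        refine Finset.prod_congr rfl fun i _ => ?_
        by_cases hi : i ∈ s
        · simp [hi]
        · have : i ≠ j := fun h => hi (h ▸ hj)
          simp [hi, this]
      · rw [if_neg hj, mul_zero]
        exact (Finset.prod_eq_zero (Finset.mem_univ j) (by simp [hj])).symm
    simp_rw [this]
    rw [hprod, Finset.prod_eq_single j]
    · simp
    · intro i _ hij; simp [hij]
    · simp
  have hmean : ∑ s : Finset (Fin m), (∏ i, if i ∈ s then x i else 1 - x i) * ((s.card : ℝ) / m) =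
      (1 / (m : ℝ)) * ∑ i, x i := by
    have hcard : ∀ s : Finset (Fin m), (s.card : ℝ) = ∑ j, if j ∈ s then (1 : ℝ) else 0 := by
      intro s; simp
    simp_rw [hcard, div_eq_mul_inv, ← mul_assoc, ← Finset.sum_mul, Finset.mul_sum]
    rw [Finset.sum_comm]
    simp_rw [hmarg]
    rw [one_mul, ← Finset.mul_sum, mul_comm]
  rwa [hmean] at h

lemma convexOn_exp_mul_binKL {p : ℝ} (h0 : 0 < p) (h1 : p < 1) (m : ℕ) :
    ConvexOn ℝ (Set.Icc 0 1) fun q => Real.exp (m * binKL q p) := by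
  have hc : ConvexOn ℝ (Set.Icc (0 : ℝ) 1) fun q => (m : ℝ) * binKL q p :=
    (convexOn_binKL h0 h1).smul (Nat.cast_nonneg m)
  refine ⟨convex_Icc 0 1, fun x hx y hy a b ha hb hab => ?_⟩
  exact (Real.exp_le_exp.2 (hc.2 hx hy ha hb hab)).trans
    (convexOn_exp.2 (Set.mem_univ _) (Set.mem_univ _) ha hb hab)

lemma average_mem_Icc {m : ℕ} (hm : 1 ≤ m) {x : Fin m → ℝ} (hx : ∀ i, x i ∈ Set.Icc (0 : ℝ) 1) :
    (1 / (m : ℝ)) * ∑ i, x i ∈ Set.Icc (0 : ℝ) 1 := by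
  have hm0 : (0 : ℝ) < m := by exact_mod_cast hm
  refine ⟨mul_nonneg (by positivity) (Finset.sum_nonneg fun i _ => (hx i).1), ?_⟩
  rw [one_div_mul_eq_div, div_le_one hm0]
  calc ∑ i, x i ≤ ∑ _i : Fin m, (1 : ℝ) := Finset.sum_le_sum fun i _ => (hx i).2
    _ = m := by simp

lemma integrable_of_mem_Icc {Ω : Type*} [MeasurableSpace Ω] {μ : Measure Ω}
    [IsFiniteMeasure μ] {X : Ω → ℝ} (hX : Measurable X) (hX01 : ∀ ω, X ω ∈ Set.Icc (0 : ℝ) 1) :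
    Integrable X μ :=
  Integrable.of_bound hX.aestronglyMeasurable 1 (Filter.Eventually.of_forall fun ω => by
    rw [Real.norm_eq_abs, abs_le]; exact ⟨by linarith [(hX01 ω).1], (hX01 ω).2⟩)

lemma integral_mem_Icc {Ω : Type*} [MeasurableSpace Ω] {μ : Measure Ω}
    [IsProbabilityMeasure μ] {X : Ω → ℝ} (hX : Measurable X)
    (hX01 : ∀ ω, X ω ∈ Set.Icc (0 : ℝ) 1) : ∫ ω, X ω ∂μ ∈ Set.Icc (0 : ℝ) 1 := by
  refine ⟨integral_nonneg fun ω => (hX01 ω).1, ?_⟩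
  calc ∫ ω, X ω ∂μ ≤ ∫ _, (1 : ℝ) ∂μ :=
        integral_mono (integrable_of_mem_Icc hX hX01) (integrable_const 1) fun ω => (hX01 ω).2
    _ = 1 := by simp

lemma ae_eq_zero_of_integral_eq_zero {Ω : Type*} [MeasurableSpace Ω] {μ : Measure Ω}
    [IsProbabilityMeasure μ] {X : Ω → ℝ} (hX : Measurable X)
    (hX01 : ∀ ω, X ω ∈ Set.Icc (0 : ℝ) 1) (h : ∫ ω, X ω ∂μ = 0) : ∀ᵐ ω ∂μ, X ω = 0 :=
  (integral_eq_zero_iff_of_nonneg (fun ω => (hX01 ω).1) (integrable_of_mem_Icc hX hX01)).1 h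

lemma ae_eq_one_of_integral_eq_one {Ω : Type*} [MeasurableSpace Ω] {μ : Measure Ω}
    [IsProbabilityMeasure μ] {X : Ω → ℝ} (hX : Measurable X)
    (hX01 : ∀ ω, X ω ∈ Set.Icc (0 : ℝ) 1) (h : ∫ ω, X ω ∂μ = 1) : ∀ᵐ ω ∂μ, X ω = 1 := by
  have h0 : ∫ ω, (1 - X ω) ∂μ = 0 := by
    rw [integral_sub (integrable_const 1) (integrable_of_mem_Icc hX hX01), h]; simp
  filter_upwards [ae_eq_zero_of_integral_eq_zero (X := fun ω => 1 - X ω)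
    (measurable_const.sub hX)
    (fun ω => ⟨by linarith [(hX01 ω).2], by linarith [(hX01 ω).1]⟩) h0] with ω hω
  linarith

/-- Maurer's bound on the exponential moment of the empirical binary KL divergence. -/
lemma lintegral_exp_mul_binKL_le {Ω : Type*} [MeasurableSpace Ω] (μ : Measure Ω)
    [IsProbabilityMeasure μ] {X : Ω → ℝ} (hX : Measurable X)
    (hX01 : ∀ ω, X ω ∈ Set.Icc (0 : ℝ) 1) {m : ℕ} (hm : 1 ≤ m)
    (h0 : 0 < ∫ ω, X ω ∂μ) (h1 : ∫ ω, X ω ∂μ < 1) :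
    ∫⁻ x : Fin m → Ω, ENNReal.ofReal
        (Real.exp (m * binKL ((1 / (m : ℝ)) * ∑ i, X (x i)) (∫ ω, X ω ∂μ)))
        ∂(Measure.pi fun _ => μ) ≤ ENNReal.ofReal (2 * √m) := by
  set p := ∫ ω, X ω ∂μ with hp
  have hXint : Integrable X μ := integrable_of_mem_Icc hX hX01
  have hw_int : ∀ s : Finset (Fin m), Integrable
      (fun x : Fin m → Ω => ∏ i, if i ∈ s then X (x i) else 1 - X (x i))
      (Measure.pi fun _ => μ) := fun s => by
    refine Integrable.fintype_prod_dep (f := fun i ω => if i ∈ s then X ω else 1 - X ω) fun i => ?_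
    by_cases hi : i ∈ s
    · simpa [hi] using hXint
    · have h1X : Integrable (fun ω => 1 - X ω) μ := (integrable_const 1).sub hXint
      simpa [hi] using h1X
  have hw : ∀ s : Finset (Fin m),
      ∫ x : Fin m → Ω, (∏ i, if i ∈ s then X (x i) else 1 - X (x i)) ∂(Measure.pi fun _ => μ) =
        p ^ s.card * (1 - p) ^ (m - s.card) := fun s => by
    rw [integral_fintype_prod_eq_prod (f := fun i ω => if i ∈ s then X ω else 1 - X ω)]
    have : ∀ i, ∫ ω, (if i ∈ s then X ω else 1 - X ω) ∂μ = if i ∈ s then p else 1 - p := by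
      intro i
      by_cases hi : i ∈ s
      · simp [hi, hp]
      · simp only [hi, if_false]
        rw [integral_sub (integrable_const 1) hXint]
        simp [hp]
    simp_rw [this]
    rw [Finset.prod_ite, Finset.prod_const, Finset.prod_const]
    congr 2
    · simp
    · rw [Finset.filter_not, Finset.card_sdiff_of_subset (Finset.filter_subset _ _)]
      simp
  have hpt : ∀ x : Fin m → Ω,
      Real.exp (m * binKL ((1 / (m : ℝ)) * ∑ i, X (x i)) p) ≤
        ∑ s : Finset (Fin m), (∏ i, if i ∈ s then X (x i) else 1 - X (x i)) *
          Real.exp (m * binKL (s.card / m) p) := fun x =>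
    convexOn_average_le_sum_powerset hm (convexOn_exp_mul_binKL h0 h1 m) (fun i => X (x i))
      fun i => hX01 _
  have hsum_int : Integrable (fun x : Fin m → Ω =>
      ∑ s : Finset (Fin m), (∏ i, if i ∈ s then X (x i) else 1 - X (x i)) *
          Real.exp (m * binKL (s.card / m) p)) (Measure.pi fun _ => μ) :=
    integrable_finsetSum _ fun s _ => (hw_int s).mul_const _
  calc _ ≤ ∫⁻ x : Fin m → Ω, ENNReal.ofReal
        (∑ s : Finset (Fin m), (∏ i, if i ∈ s then X (x i) else 1 - X (x i)) *
          Real.exp (m * binKL (s.card / m) p)) ∂(Measure.pi fun _ => μ) :=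
        lintegral_mono fun x => ENNReal.ofReal_le_ofReal (hpt x)
    _ = ENNReal.ofReal (∫ x : Fin m → Ω,
        ∑ s : Finset (Fin m), (∏ i, if i ∈ s then X (x i) else 1 - X (x i)) *
          Real.exp (m * binKL (s.card / m) p) ∂(Measure.pi fun _ => μ)) :=
        (ofReal_integral_eq_lintegral_ofReal hsum_int
          (Filter.Eventually.of_forall fun x => (Real.exp_pos _).le.trans (hpt x))).symm
    _ ≤ _ := by
        refine ENNReal.ofReal_le_ofReal ?_
        rw [integral_finsetSum _ fun s _ => (hw_int s).mul_const _]
        simp_rw [integral_mul_const, hw]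
        have hcard : ∀ s : Finset (Fin m), s.card ≤ m := fun s => by
          simpa using s.card_le_univ
        calc _ = ∑ s : Finset (Fin m), maxLik s.card (m - s.card) :=
              Finset.sum_congr rfl fun s _ => by
                rw [mul_comm, exp_mul_binKL_eq hm (hcard s) h0 h1]
          _ = ∑ k ∈ Finset.range (m + 1), (m.choose k : ℝ) * maxLik k (m - k) := by
              rw [← Finset.powerset_univ,
                Finset.sum_powerset_apply_card (fun k => maxLik k (m - k))]
              simp
          _ ≤ _ := sum_choose_mul_maxLik_le hm

lemma exp_mul_binKL_le_prod {n : ℕ} (hn : 1 ≤ n) {x : Fin n → ℝ}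
    (hx : ∀ i, x i ∈ Set.Icc (0 : ℝ) 1) {p q : ℝ} (h1 : p < 1) (hq : 0 ≤ q) (h0 : 0 < p)
    (hqp : q ≤ p) (h : (1 / (n : ℝ)) * ∑ i, x i ≤ q) :
    Real.exp (n * binKL q p) ≤ ∏ i, (x i * (q / p) + (1 - x i) * ((1 - q) / (1 - p))) := by
  have hn0 : (0 : ℝ) < n := by exact_mod_cast hn
  have hr : 0 < (1 - q) / (1 - p) := div_pos (by linarith) (by linarith)
  rw [one_div_mul_eq_div, div_le_iff₀ hn0] at h
  rcases hq.eq_or_lt with rfl | hq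
  · rw [zero_mul] at h
    have hz : ∀ i, x i = 0 := fun i =>
      (Finset.sum_eq_zero_iff_of_nonneg fun i _ => (hx i).1).1
        (le_antisymm h (Finset.sum_nonneg fun i _ => (hx i).1)) i (Finset.mem_univ i)
    simp only [sub_zero] at hr
    simp [hz, binKL, Real.exp_nat_mul, Real.exp_neg, Real.exp_log (by linarith : 0 < 1 - p)]
  · have hA : Real.log (q / p) ≤ Real.log ((1 - q) / (1 - p)) := by
      refine (Real.log_nonpos (by positivity) ((div_le_one h0).2 hqp)).trans
        (Real.log_nonneg ?_)
      rw [le_div_iff₀ (by linarith)]; linarith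
    set A := Real.log (q / p) with hAdef
    set B := Real.log ((1 - q) / (1 - p)) with hBdef
    calc Real.exp (n * binKL q p) ≤ Real.exp (∑ i, (x i * A + (1 - x i) * B)) := by
          refine Real.exp_le_exp.2 ?_
          have : ∑ i, (x i * A + (1 - x i) * B) = (∑ i, x i) * (A - B) + n * B := by
            calc _ = ∑ i, (x i * (A - B) + B) := Finset.sum_congr rfl fun i _ => by ring
              _ = _ := by rw [Finset.sum_add_distrib, ← Finset.sum_mul]; simp
          rw [this, binKL, ← hAdef, ← hBdef]
          nlinarith
      _ = ∏ i, Real.exp (x i * A + (1 - x i) * B) := Real.exp_sum _ _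
      _ ≤ _ := by
          refine Finset.prod_le_prod (fun i _ => (Real.exp_pos _).le) fun i _ => ?_
          have hc := convexOn_exp.2 (Set.mem_univ A) (Set.mem_univ B) (hx i).1
            (by linarith [(hx i).2] : 0 ≤ 1 - x i) (by ring)
          simp only [smul_eq_mul] at hc
          rwa [hAdef, hBdef, Real.exp_log (by positivity), Real.exp_log hr] at hc

/-- Chernoff's lower-tail bound for averages of `[0,1]`-valued i.i.d. random variables. -/
lemma pi_average_le_le_exp {Ω : Type*} [MeasurableSpace Ω] (μ : Measure Ω)
    [IsProbabilityMeasure μ] {X : Ω → ℝ} (hX : Measurable X)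
    (hX01 : ∀ ω, X ω ∈ Set.Icc (0 : ℝ) 1) {n : ℕ} (hn : 1 ≤ n)
    (h0 : 0 < ∫ ω, X ω ∂μ) (h1 : ∫ ω, X ω ∂μ < 1) {q : ℝ} (hq : 0 ≤ q) (hqp : q ≤ ∫ ω, X ω ∂μ) :
    (Measure.pi fun _ : Fin n => μ) {x | (1 / (n : ℝ)) * ∑ i, X (x i) ≤ q} ≤
      ENNReal.ofReal (Real.exp (-(n * binKL q (∫ ω, X ω ∂μ)))) := by
  set p := ∫ ω, X ω ∂μ with hp
  have hXint : Integrable X μ := integrable_of_mem_Icc hX hX01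
  have hr : 0 < (1 - q) / (1 - p) := div_pos (by linarith) (by linarith)
  let M : (Fin n → Ω) → ℝ := fun x =>
    ∏ i, (X (x i) * (q / p) + (1 - X (x i)) * ((1 - q) / (1 - p)))
  have h1X : Integrable (fun ω => 1 - X ω) μ := (integrable_const 1).sub hXint
  have hfac : Integrable (fun ω => X ω * (q / p) + (1 - X ω) * ((1 - q) / (1 - p))) μ :=
    (hXint.mul_const _).add (h1X.mul_const _)
  have hMint : Integrable M (Measure.pi fun _ => μ) :=
    Integrable.fintype_prod_dep fun _ => hfac
  have hM0 : ∀ x, 0 ≤ M x := fun x => Finset.prod_nonneg fun i _ => by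
    have := hX01 (x i)
    exact add_nonneg (mul_nonneg this.1 (div_nonneg hq h0.le))
      (mul_nonneg (by linarith [this.2]) hr.le)
  have hM1 : ∫ x, M x ∂(Measure.pi fun _ => μ) = 1 := by
    rw [integral_fintype_prod_eq_prod
      (f := fun _ ω => X ω * (q / p) + (1 - X ω) * ((1 - q) / (1 - p)))]
    refine Finset.prod_eq_one fun i _ => ?_
    rw [integral_add (hXint.mul_const _) (h1X.mul_const _), integral_mul_const,
      integral_mul_const, integral_sub (integrable_const 1) hXint, ← hp]
    have : (1 : ℝ) - p ≠ 0 := by linarith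
    simp
    field_simp
    ring
  have hmark := mul_meas_ge_le_integral_of_nonneg (Filter.Eventually.of_forall hM0) hMint
    (Real.exp (n * binKL q p))
  rw [hM1] at hmark
  rw [← ofReal_measureReal (measure_ne_top _ _)]
  refine ENNReal.ofReal_le_ofReal ?_
  rw [Real.exp_neg, ← one_div, le_div_iff₀ (Real.exp_pos _), mul_comm]
  refine le_trans (mul_le_mul_of_nonneg_left (measureReal_mono fun x hx => ?_)
    (Real.exp_pos _).le) hmark
  exact exp_mul_binKL_le_prod hn (fun i => hX01 (x i)) h1 hq h0 hqp hx

/-- Lower-tail confidence bound in binary KL form. -/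
lemma pi_not_binKL_le {Ω : Type*} [MeasurableSpace Ω] (μ : Measure Ω)
    [IsProbabilityMeasure μ] {X : Ω → ℝ} (hX : Measurable X)
    (hX01 : ∀ ω, X ω ∈ Set.Icc (0 : ℝ) 1) {n : ℕ} (hn : 1 ≤ n) (b : ℝ) :
    (Measure.pi fun _ : Fin n => μ) {x | ¬ (∫ ω, X ω ∂μ ≤ (1 / (n : ℝ)) * ∑ i, X (x i) ∨
      ∫ ω, X ω ∂μ < 1 ∧ binKL ((1 / (n : ℝ)) * ∑ i, X (x i)) (∫ ω, X ω ∂μ) ≤ b)} ≤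
      ENNReal.ofReal (Real.exp (-(n * b))) := by
  set p := ∫ ω, X ω ∂μ with hp
  have hp01 : p ∈ Set.Icc (0 : ℝ) 1 := integral_mem_Icc hX hX01
  have hn0 : (0 : ℝ) < n := by exact_mod_cast hn
  have havg : ∀ x : Fin n → Ω, (1 / (n : ℝ)) * ∑ i, X (x i) ∈ Set.Icc (0 : ℝ) 1 := fun x =>
    average_mem_Icc hn fun i => hX01 (x i)
  rcases hp01.1.eq_or_lt with h0 | h0
  · refine le_of_eq_of_le (measure_mono_null (t := ∅) (fun x hx => hx (Or.inl ?_))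
      measure_empty) zero_le
    rw [← h0]; exact (havg x).1
  rcases hp01.2.eq_or_lt with h1 | h1
  · have hae := ae_eq_one_of_integral_eq_one hX hX01 (hp.symm.trans h1)
    have hall : ∀ᵐ x ∂(Measure.pi fun _ : Fin n => μ), ∀ i, X (x i) = 1 :=
      ae_all_iff.2 fun i =>
        (measurePreserving_eval (fun _ : Fin n => μ) i).quasiMeasurePreserving.ae hae
    refine le_of_eq_of_le ?_ zero_le
    have : ∀ᵐ x ∂(Measure.pi fun _ : Fin n => μ), (p ≤ (1 / (n : ℝ)) * ∑ i, X (x i) ∨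
        p < 1 ∧ binKL ((1 / (n : ℝ)) * ∑ i, X (x i)) p ≤ b) := by
      filter_upwards [hall] with x hx
      left
      simp [hx, h1, hn0.ne']
    exact this
  · by_cases hT : ({q | 0 ≤ q ∧ q ≤ p ∧ b < binKL q p}).Nonempty
    · set T := {q | 0 ≤ q ∧ q ≤ p ∧ b < binKL q p} with hTdef
      have hbdd : BddAbove T := ⟨p, fun q hq => hq.2.1⟩
      have hcl : sSup T ∈ closure T := csSup_mem_closure hT hbdd
      have hsub : closure T ⊆ {q | b ≤ binKL q p} :=
        closure_minimal (fun q hq => hq.2.2.le)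
          (isClosed_le continuous_const (continuous_binKL h0 h1))
      obtain ⟨q₀, hq₀⟩ := hT
      have hs0 : 0 ≤ sSup T := hq₀.1.trans (le_csSup hbdd hq₀)
      have hsp : sSup T ≤ p := csSup_le ⟨q₀, hq₀⟩ fun q hq => hq.2.1
      refine (measure_mono fun x hx => ?_).trans
        ((pi_average_le_le_exp μ hX hX01 hn h0 h1 hs0 hsp).trans (ENNReal.ofReal_le_ofReal
          (Real.exp_le_exp.2 (neg_le_neg (mul_le_mul_of_nonneg_left (hsub hcl) hn0.le)))))
      simp only [Set.mem_ofPred_eq, not_or, not_and, not_le] at hx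
      exact le_csSup hbdd ⟨(havg x).1, hx.1.le, hx.2 h1⟩
    · refine le_of_eq_of_le (measure_mono_null (t := ∅) (fun x hx => ?_) measure_empty) zero_le
      simp only [Set.mem_ofPred_eq, not_or, not_and, not_le] at hx
      exact hT ⟨_, (havg x).1, hx.1.le, hx.2 h1⟩

open Classical in
/-- Exponentiated empirical binary KL divergence, with value `∞` where the divergence is infinite
because `p ∈ {0,1}` and `q ≠ p`. -/
noncomputable def expKL (m : ℕ) (q p : ℝ) : ℝ≥0∞ :=
  if (p = 0 → q = 0) ∧ (p = 1 → q = 1) then ENNReal.ofReal (Real.exp (m * binKL q p)) else ∞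

lemma measurable_expKL (m : ℕ) : Measurable fun x : ℝ × ℝ => expKL m x.1 x.2 := by
  unfold expKL
  refine Measurable.ite ?_ ?_ measurable_const
  · have h : ∀ c : ℝ, MeasurableSet {x : ℝ × ℝ | x.2 = c → x.1 = c} := fun c => by
      have : {x : ℝ × ℝ | x.2 = c → x.1 = c} = {x | x.2 = c}ᶜ ∪ {x | x.1 = c} := by
        ext x; simp [imp_iff_not_or]
      rw [this]
      exact (measurableSet_eq_fun measurable_snd measurable_const).compl.union
        (measurableSet_eq_fun measurable_fst measurable_const)
    exact (h 0).inter (h 1)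
  · exact ENNReal.measurable_ofReal.comp
      (Real.measurable_exp.comp (measurable_binKL.const_mul (m : ℝ)))

lemma lintegral_expKL_le {Ω : Type*} [MeasurableSpace Ω] (μ : Measure Ω)
    [IsProbabilityMeasure μ] {X : Ω → ℝ} (hX : Measurable X)
    (hX01 : ∀ ω, X ω ∈ Set.Icc (0 : ℝ) 1) {m : ℕ} (hm : 1 ≤ m) :
    ∫⁻ x : Fin m → Ω, expKL m ((1 / (m : ℝ)) * ∑ i, X (x i)) (∫ ω, X ω ∂μ)
        ∂(Measure.pi fun _ => μ) ≤ ENNReal.ofReal (2 * √m) := by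
  have hm0 : (0 : ℝ) < m := by exact_mod_cast hm
  have hsqrt : (1 : ℝ≥0∞) ≤ ENNReal.ofReal (2 * √m) := by
    rw [ENNReal.one_le_ofReal]
    have : 1 ≤ √(m : ℝ) := Real.one_le_sqrt.2 (by exact_mod_cast hm)
    linarith
  have hp01 := integral_mem_Icc (μ := μ) hX hX01
  have hconst : ∀ c : ℝ, (c = 0 ∨ c = 1) → (∫ ω, X ω ∂μ) = c → (∀ᵐ ω ∂μ, X ω = c) →
      ∫⁻ x : Fin m → Ω, expKL m ((1 / (m : ℝ)) * ∑ i, X (x i)) (∫ ω, X ω ∂μ)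
        ∂(Measure.pi fun _ => μ) ≤ ENNReal.ofReal (2 * √m) := by
    intro c hc hpc hae
    have hall : ∀ᵐ x ∂(Measure.pi fun _ : Fin m => μ), ∀ i, X (x i) = c :=
      ae_all_iff.2 fun i =>
        (measurePreserving_eval (fun _ : Fin m => μ) i).quasiMeasurePreserving.ae hae
    calc _ = ∫⁻ _ : Fin m → Ω, 1 ∂(Measure.pi fun _ => μ) := by
          refine lintegral_congr_ae ?_
          filter_upwards [hall] with x hx
          have : (1 / (m : ℝ)) * ∑ i, X (x i) = c := by simp [hx, hm0.ne']
          rw [this, hpc]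
          rcases hc with rfl | rfl <;> simp [expKL, binKL]
      _ = 1 := by simp
      _ ≤ _ := hsqrt
  rcases hp01.1.eq_or_lt with h0 | h0
  · exact hconst 0 (Or.inl rfl) h0.symm (ae_eq_zero_of_integral_eq_zero hX hX01 h0.symm)
  rcases hp01.2.eq_or_lt with h1 | h1
  · exact hconst 1 (Or.inr rfl) h1 (ae_eq_one_of_integral_eq_one hX hX01 h1)
  · have : ∀ q, expKL m q (∫ ω, X ω ∂μ) =
        ENNReal.ofReal (Real.exp (m * binKL q (∫ ω, X ω ∂μ))) := fun q =>
      if_pos ⟨fun h => absurd h h0.ne', fun h => absurd h h1.ne⟩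
    simp_rw [this]
    exact lintegral_exp_mul_binKL_le μ hX hX01 hm h0 h1

/-- The Donsker–Varadhan change of measure inequality for nonnegative functions. -/
lemma integral_le_integral_log_rnDeriv_add_log {α : Type*} [MeasurableSpace α] {Q P : Measure α}
    [IsProbabilityMeasure Q] [IsProbabilityMeasure P] (hQP : Q ≪ P)
    (hllr : Integrable (fun x => Real.log (Q.rnDeriv P x).toReal) Q) {g : α → ℝ}
    (hg : Measurable g) (hg0 : ∀ᵐ x ∂Q, 0 ≤ g x) {L : ℝ} (hL : 0 < L)
    (hexp : ∫⁻ x, ENNReal.ofReal (Real.exp (g x)) ∂P ≤ ENNReal.ofReal L) :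
    Integrable g Q ∧ ∫ x, g x ∂Q ≤ ∫ x, Real.log (Q.rnDeriv P x).toReal ∂Q + Real.log L := by
  set r : α → ℝ := fun x => (Q.rnDeriv P x).toReal with hr
  have hrmeas : Measurable r := (Measure.measurable_rnDeriv Q P).ennreal_toReal
  have hrpos : ∀ᵐ x ∂Q, 0 < r x := by
    filter_upwards [Measure.rnDeriv_pos hQP, hQP.ae_le (Measure.rnDeriv_lt_top Q P)] with x h1 h2
    exact ENNReal.toReal_pos h1.ne' h2.ne
  set f : α → ℝ := fun x => Real.exp (g x) / r x with hf
  have hfmeas : Measurable f := (Real.measurable_exp.comp hg).div hrmeas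
  have hf0 : ∀ x, 0 ≤ f x := fun x => div_nonneg (Real.exp_pos _).le ENNReal.toReal_nonneg
  have hfle : ∫⁻ x, ENNReal.ofReal (f x) ∂Q ≤ ENNReal.ofReal L := by
    rw [← lintegral_rnDeriv_mul hQP hfmeas.ennreal_ofReal.aemeasurable]
    refine le_trans (lintegral_mono_ae ?_) hexp
    filter_upwards [Measure.rnDeriv_lt_top Q P] with x hx
    rw [← ENNReal.ofReal_toReal hx.ne, ← ENNReal.ofReal_mul ENNReal.toReal_nonneg]
    refine ENNReal.ofReal_le_ofReal ?_
    change r x * (Real.exp (g x) / r x) ≤ _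
    rcases eq_or_ne (r x) 0 with h | h
    · simp [h, (Real.exp_pos _).le]
    · rw [mul_div_cancel₀ _ h]
  have hfint : Integrable f Q := by
    refine ⟨hfmeas.aestronglyMeasurable, ?_⟩
    rw [hasFiniteIntegral_iff_ofReal (Filter.Eventually.of_forall hf0)]
    exact hfle.trans_lt ENNReal.ofReal_lt_top
  have hfL : ∫ x, f x ∂Q ≤ L := by
    rw [integral_eq_lintegral_of_nonneg_ae (Filter.Eventually.of_forall hf0)
      hfmeas.aestronglyMeasurable]
    exact ENNReal.toReal_le_of_le_ofReal hL.le hfle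
  set u : α → ℝ := fun x => Real.log (r x) + (f x / L + (Real.log L - 1)) with hu
  have hfL' : Integrable (fun x => f x / L + (Real.log L - 1)) Q :=
    (hfint.div_const L).add (integrable_const _)
  have huint : Integrable u Q := hllr.add hfL'
  have hgu : ∀ᵐ x ∂Q, g x ≤ u x := by
    filter_upwards [hrpos] with x hx
    have h := Real.log_le_sub_one_of_pos (x := f x / L)
      (div_pos (div_pos (Real.exp_pos _) hx) hL)
    rw [hf, Real.log_div (div_pos (Real.exp_pos _) hx).ne' hL.ne',
      Real.log_div (Real.exp_pos _).ne' hx.ne', Real.log_exp] at h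
    simp only [hu, hf]
    linarith
  have hgint : Integrable g Q := by
    refine huint.mono' hg.aestronglyMeasurable ?_
    filter_upwards [hg0, hgu] with x h0 h1
    rwa [Real.norm_of_nonneg h0]
  refine ⟨hgint, (integral_mono_ae hgint huint hgu).trans ?_⟩
  have hL1 : (∫ x, f x ∂Q) / L ≤ 1 := (div_le_one hL).2 hfL
  rw [hu, integral_add hllr hfL', integral_add (hfint.div_const L) (integrable_const _),
    integral_div]
  simp
  linarith

/-- Joint convexity of the binary KL divergence, in integral form. -/
lemma binKL_integral_le {α : Type*} [MeasurableSpace α] {Q : Measure α} [IsProbabilityMeasure Q]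
    {q p : α → ℝ} (hq : Measurable q) (hp : Measurable p)
    (hq01 : ∀ x, q x ∈ Set.Icc (0 : ℝ) 1) (hp01 : ∀ x, p x ∈ Set.Icc (0 : ℝ) 1)
    (hgood : ∀ᵐ x ∂Q, (p x = 0 → q x = 0) ∧ (p x = 1 → q x = 1))
    (hint : Integrable (fun x => binKL (q x) (p x)) Q)
    (h0 : 0 < ∫ x, p x ∂Q) (h1 : ∫ x, p x ∂Q < 1) (hlt : ∫ x, q x ∂Q < 1) :
    binKL (∫ x, q x ∂Q) (∫ x, p x ∂Q) ≤ ∫ x, binKL (q x) (p x) ∂Q := by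
  have hqint := integrable_of_mem_Icc (μ := Q) hq hq01
  have hpint := integrable_of_mem_Icc (μ := Q) hp hp01
  set q₀ := ∫ x, q x ∂Q with hq₀
  set p₀ := ∫ x, p x ∂Q with hp₀
  have hq₀0 : 0 ≤ q₀ := (integral_mem_Icc hq hq01).1
  set c := q₀ / p₀ with hc
  set d := (1 - q₀) / (1 - p₀) with hd
  have hd0 : 0 < d := div_pos (by linarith) (by linarith)
  have hfst : ∀ᵐ x ∂Q, q x * Real.log c + q x - p x * c ≤ q x * Real.log (q x / p x) := by
    rcases hq₀0.eq_or_lt with h | h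
    · filter_upwards [ae_eq_zero_of_integral_eq_zero hq hq01 h.symm] with x hx
      simp [hx, hc, ← h]
    · filter_upwards [hgood] with x hx
      exact mul_log_div_ge (hq01 x).1 (hp01 x).1 (div_pos h h0) hx.1
  have hae : ∀ᵐ x ∂Q, q x * (Real.log c - Real.log d) - p x * (c - d) +
      (Real.log d + 1 - d) ≤ binKL (q x) (p x) := by
    filter_upwards [hfst, hgood] with x hx hgx
    have := mul_log_div_ge (x := 1 - q x) (y := 1 - p x) (by linarith [(hq01 x).2])
      (by linarith [(hp01 x).2]) hd0 fun h => by linarith [hgx.2 (by linarith)]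
    rw [binKL]
    linarith
  have hi1 : Integrable (fun x => q x * (Real.log c - Real.log d)) Q := hqint.mul_const _
  have hi2 : Integrable (fun x => p x * (c - d)) Q := hpint.mul_const _
  have hi3 : Integrable (fun x => q x * (Real.log c - Real.log d) - p x * (c - d)) Q :=
    hi1.sub hi2
  have hmono := integral_mono_ae (hi3.add (integrable_const _)) hint hae
  refine le_trans (le_of_eq ?_) hmono
  change _ = ∫ x, (q x * (Real.log c - Real.log d) - p x * (c - d) + (Real.log d + 1 - d)) ∂Q
  rw [integral_add hi3 (integrable_const _), integral_sub hi1 hi2, integral_mul_const,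
    integral_mul_const, ← hq₀, ← hp₀, binKL, ← hc, ← hd]
  have e1 : p₀ * c = q₀ := by rw [hc]; field_simp
  have e2 : (1 - p₀) * d = 1 - q₀ := by
    rw [hd]; field_simp [(by linarith : (1 : ℝ) - p₀ ≠ 0)]
  simp
  linear_combination e1 + e2

/-- Deterministic part of the PAC-Bayes-kl bound. -/
lemma integral_le_klInv_of_lintegral_expKL_le {α : Type*} [MeasurableSpace α] {Q P : Measure α}
    [IsProbabilityMeasure Q] [IsProbabilityMeasure P]
    {q p : α → ℝ} (hq : Measurable q) (hp : Measurable p)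
    (hq01 : ∀ x, q x ∈ Set.Icc (0 : ℝ) 1) (hp01 : ∀ x, p x ∈ Set.Icc (0 : ℝ) 1)
    {m : ℕ} (hm : 1 ≤ m) {L : ℝ} (hL : 0 < L)
    (h : ∫⁻ x, expKL m (q x) (p x) ∂P ≤ ENNReal.ofReal L) :
    ∫ x, p x ∂Q ≤ klInv (∫ x, q x ∂Q)
      ((klDiv' Q P + ENNReal.ofReal (Real.log L)) / (m : ℝ≥0∞)) := by
  have hm0 : (0 : ℝ) < m := by exact_mod_cast hm
  have hq₀ := integral_mem_Icc (μ := Q) hq hq01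
  have hp₀ := integral_mem_Icc (μ := Q) hp hp01
  by_cases hac : Q ≪ P ∧ Integrable (fun x => Real.log (Q.rnDeriv P x).toReal) Q
  swap
  · rw [klDiv', if_neg hac, top_add, ENNReal.top_div_of_ne_top (ENNReal.natCast_ne_top m)]
    exact hp₀.2.trans (one_le_klInv_top hq₀.2)
  have hmeas : Measurable fun x => expKL m (q x) (p x) := (measurable_expKL m).comp (hq.prodMk hp)
  have hgoodP : ∀ᵐ x ∂P, (p x = 0 → q x = 0) ∧ (p x = 1 → q x = 1) := by
    filter_upwards [ae_lt_top hmeas (h.trans_lt ENNReal.ofReal_lt_top).ne] with x hx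
    by_contra hn
    rw [expKL, if_neg hn] at hx
    exact lt_irrefl _ hx
  have hgood := hac.1.ae_le hgoodP
  have hg : Measurable fun x => (m : ℝ) * binKL (q x) (p x) :=
    (measurable_binKL.comp (hq.prodMk hp)).const_mul _
  obtain ⟨hint, hDV⟩ := integral_le_integral_log_rnDeriv_add_log hac.1 hac.2 hg
    (by
      filter_upwards [hgood] with x hx
      exact mul_nonneg hm0.le (binKL_nonneg (hq01 x).1 (hq01 x).2 (hp01 x).1 (hp01 x).2 hx.1 hx.2))
    hL
    (by
      refine le_trans (lintegral_mono fun x => ?_) h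
      rw [expKL]
      split_ifs
      · exact le_rfl
      · exact le_top)
  have hint' : Integrable (fun x => binKL (q x) (p x)) Q := by
    refine (hint.const_mul (m : ℝ)⁻¹).congr (Filter.Eventually.of_forall fun x => ?_)
    simp [hm0.ne']
  rw [integral_const_mul] at hDV
  refine le_klInv hq₀.1 hq₀.2 (or_iff_not_imp_left.2 fun hlt => ?_)
  rw [not_le] at hlt
  have hp1 : ∫ x, p x ∂Q < 1 := by
    refine hp₀.2.lt_of_ne fun h1 => ?_
    have : ∫ x, q x ∂Q = 1 := by
      rw [integral_congr_ae (g := fun _ => (1 : ℝ))]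
      · simp
      · filter_upwards [ae_eq_one_of_integral_eq_one hp hp01 h1, hgood] with x hx hgx
        exact hgx.2 hx
    linarith
  have hconv := binKL_integral_le hq hp hq01 hp01 hgood hint' (hq₀.1.trans_lt hlt) hp1
    (hlt.trans hp1)
  refine ⟨hp1, ?_⟩
  rw [klDiv', if_pos hac, ENNReal.le_div_iff_mul_le (by simp; omega) (by simp),
    ← ENNReal.ofReal_natCast, ← ENNReal.ofReal_mul' hm0.le]
  refine le_trans (ENNReal.ofReal_le_ofReal ?_) ENNReal.ofReal_add_le
  nlinarith

lemma measurable_pi_const {α β : Type*} [MeasurableSpace α] [MeasurableSpace β] (n : ℕ)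
    {κ : α → Measure β} (hκ : Measurable κ) (hκprob : ∀ a, IsProbabilityMeasure (κ a)) :
    Measurable fun a => Measure.pi fun _ : Fin n => κ a := by
  refine Measurable.measure_of_isPiSystem_of_isProbabilityMeasure generateFrom_pi.symm
    isPiSystem_pi ?_
  rintro s ⟨t, ht, rfl⟩
  simp_rw [Measure.pi_pi]
  exact Finset.measurable_prod _ fun i _ =>
    (Measure.measurable_coe (ht i (Set.mem_univ i))).comp hκ

/-- **Fully empirical PAC-Bayes bound** for a data-dependent posterior `κ` (a Markov kernel
from samples to distributions over hypotheses) combined with a Monte Carlo estimate of the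
expected empirical risk: with probability at least `1 − δ − δ'` over the joint draw of
`S ~ D^⊗m` and `W₁,…,Wₙ ~ (κ S)^⊗n`,
`R_D(κ S) ≤ kl⁻¹( kl⁻¹((1/n)∑ᵢ R̂_S(Wᵢ), (1/n)ln(2/δ')), (KL(κ S‖P) + ln(2√m/δ))/m )`. -/
theorem fully_empirical_pac_bayes
    {H Z : Type*} [MeasurableSpace H] [MeasurableSpace Z]
    (ℓ : H → Z → ℝ) (hℓmeas : Measurable fun p : H × Z => ℓ p.1 p.2)
    (hℓbdd : ∀ h z, ℓ h z ∈ Set.Icc (0 : ℝ) 1)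
    (D : Measure Z) [IsProbabilityMeasure D]
    (m n : ℕ) (hm : 1 ≤ m) (hn : 1 ≤ n)
    (P : Measure H) [IsProbabilityMeasure P]
    (δ δ' : ℝ) (hδ : δ ∈ Set.Ioo (0 : ℝ) 1) (hδ' : δ' ∈ Set.Ioo (0 : ℝ) 1)
    (hδδ' : δ + δ' < 1)
    (κ : (Fin m → Z) → Measure H) (hκmeas : Measurable κ)
    (hκprob : ∀ S, IsProbabilityMeasure (κ S)) :
    ENNReal.ofReal (1 - δ - δ') ≤
      ((Measure.pi fun _ : Fin m => D).bind
          fun S => (Measure.pi fun _ : Fin n => κ S).map fun W => (S, W))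
        {p : (Fin m → Z) × (Fin n → H) |
          riskDQ ℓ D (κ p.1) ≤
            klInv
              (klInv ((1 / (n : ℝ)) * ∑ i, riskS ℓ p.1 (p.2 i))
                (ENNReal.ofReal ((1 / (n : ℝ)) * Real.log (2 / δ'))))
              ((klDiv' (κ p.1) P + ENNReal.ofReal (Real.log (2 * Real.sqrt m / δ))) /
                (m : ℝ≥0∞))} := by
  obtain ⟨hδ0, -⟩ := hδ
  obtain ⟨hδ'0, -⟩ := hδ'
  have hm0 : (0 : ℝ) < m := by exact_mod_cast hm
  have hn0 : (0 : ℝ) < n := by exact_mod_cast hn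
  set b : ℝ := (1 / (n : ℝ)) * Real.log (2 / δ') with hb
  set L : ℝ := 2 * √m / δ with hL
  have hL0 : 0 < L := by have := Real.sqrt_pos.2 hm0; positivity
  have hsec : ∀ h, Measurable (ℓ h) := fun h => hℓmeas.comp measurable_prodMk_left
  have hrS : Measurable fun x : (Fin m → Z) × H => riskS ℓ x.1 x.2 := by
    unfold riskS
    refine Measurable.const_mul (Finset.measurable_sum _ fun j _ => ?_) _
    exact hℓmeas.comp (measurable_snd.prodMk ((measurable_pi_apply j).comp measurable_fst))
  have hrD : Measurable (riskD ℓ D) :=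
    (hℓmeas.stronglyMeasurable.integral_prod_right' (ν := D)).measurable
  have hrS01 : ∀ S h, riskS ℓ S h ∈ Set.Icc (0 : ℝ) 1 := fun S h =>
    average_mem_Icc hm fun j => hℓbdd h (S j)
  have hrD01 : ∀ h, riskD ℓ D h ∈ Set.Icc (0 : ℝ) 1 := fun h =>
    integral_mem_Icc (hsec h) (hℓbdd h)
  have hrSsec : ∀ S : Fin m → Z, Measurable (riskS ℓ S) := fun S =>
    hrS.comp measurable_prodMk_left
  let κ' : ProbabilityTheory.Kernel (Fin m → Z) H := ⟨κ, hκmeas⟩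
  have : ProbabilityTheory.IsMarkovKernel κ' := ⟨hκprob⟩
  let K : ProbabilityTheory.Kernel (Fin m → Z) (Fin n → H) :=
    ⟨fun S => Measure.pi fun _ => κ S, measurable_pi_const n hκmeas hκprob⟩
  have : ProbabilityTheory.IsMarkovKernel K := ⟨fun S => by
    change IsProbabilityMeasure (Measure.pi fun _ => κ S); infer_instance⟩
  have hrSQ : Measurable fun S => riskSQ ℓ S (κ S) :=
    (hrS.stronglyMeasurable.integral_kernel_prod_right' (κ := κ')).measurable
  have hKpair : Measurable fun S =>
      (Measure.pi fun _ : Fin n => κ S).map fun W => (S, W) := by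
    change Measurable fun S => (K S).map fun W => (S, W)
    refine Measure.measurable_of_measurable_coe _ fun t ht => ?_
    simp_rw [Measure.map_apply measurable_prodMk_left ht]
    exact ProbabilityTheory.Kernel.measurable_kernel_prodMk_left ht
  set ν := (Measure.pi fun _ : Fin m => D).bind
    fun S => (Measure.pi fun _ : Fin n => κ S).map fun W => (S, W) with hν
  have hνapply : ∀ t, MeasurableSet t →
      ν t = ∫⁻ S, K S (Prod.mk S ⁻¹' t) ∂(Measure.pi fun _ : Fin m => D) := fun t ht => by
    rw [hν, Measure.bind_apply ht hKpair.aemeasurable]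
    exact lintegral_congr fun S => Measure.map_apply measurable_prodMk_left ht
  have : IsProbabilityMeasure ν := ⟨by rw [hνapply _ MeasurableSet.univ]; simp⟩
  let F : (Fin m → Z) × H → ℝ≥0∞ := fun x => expKL m (riskS ℓ x.1 x.2) (riskD ℓ D x.2)
  have hF : Measurable F := (measurable_expKL m).comp (hrS.prodMk (hrD.comp measurable_snd))
  have hFS : Measurable fun S => ∫⁻ h, F (S, h) ∂P := hF.lintegral_prod_right'
  have hFint : ∫⁻ S, ∫⁻ h, F (S, h) ∂P ∂(Measure.pi fun _ : Fin m => D) ≤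
      ENNReal.ofReal (2 * √m) := by
    rw [lintegral_lintegral_swap hF.aemeasurable]
    calc _ ≤ ∫⁻ _ : H, ENNReal.ofReal (2 * √m) ∂P :=
          lintegral_mono fun h => lintegral_expKL_le D (hsec h) (hℓbdd h) hm
      _ = _ := by simp
  let avg : (Fin m → Z) × (Fin n → H) → ℝ := fun x => (1 / (n : ℝ)) * ∑ i, riskS ℓ x.1 (x.2 i)
  have havg : Measurable avg :=
    Measurable.const_mul (Finset.measurable_sum _ fun i _ => hrS.comp
      (measurable_fst.prodMk ((measurable_pi_apply i).comp measurable_snd))) _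
  have havg01 : ∀ x, avg x ∈ Set.Icc (0 : ℝ) 1 := fun x => average_mem_Icc hn fun i => hrS01 _ _
  have hrSQ' : Measurable fun x : (Fin m → Z) × (Fin n → H) => riskSQ ℓ x.1 (κ x.1) :=
    hrSQ.comp measurable_fst
  let B₁ : Set ((Fin m → Z) × (Fin n → H)) :=
    Prod.fst ⁻¹' {S | ENNReal.ofReal L ≤ ∫⁻ h, F (S, h) ∂P}
  let B₂ : Set ((Fin m → Z) × (Fin n → H)) :=
    {x | ¬ (riskSQ ℓ x.1 (κ x.1) ≤ avg x ∨
      riskSQ ℓ x.1 (κ x.1) < 1 ∧ binKL (avg x) (riskSQ ℓ x.1 (κ x.1)) ≤ b)}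
  have hB₁meas : MeasurableSet B₁ := measurable_fst (measurableSet_le measurable_const hFS)
  have hB₂meas : MeasurableSet B₂ :=
    ((measurableSet_le hrSQ' havg).union ((measurableSet_lt hrSQ' measurable_const).inter
      (measurableSet_le (measurable_binKL.comp (havg.prodMk hrSQ')) measurable_const))).compl
  have hB₁ : ν B₁ ≤ ENNReal.ofReal δ := by
    rw [hνapply _ hB₁meas]
    calc _ = ∫⁻ S, Set.indicator {S | ENNReal.ofReal L ≤ ∫⁻ h, F (S, h) ∂P} 1 S
          ∂(Measure.pi fun _ : Fin m => D) := by
          refine lintegral_congr fun S => ?_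
          by_cases hS : S ∈ {S | ENNReal.ofReal L ≤ ∫⁻ h, F (S, h) ∂P}
          · have : Prod.mk S ⁻¹' B₁ = Set.univ := Set.eq_univ_of_forall fun _ => hS
            rw [this, Set.indicator_of_mem hS]; simp
          · have : Prod.mk S ⁻¹' B₁ = ∅ := Set.eq_empty_of_forall_notMem fun _ hx => hS hx
            rw [this, Set.indicator_of_notMem hS]; simp
      _ = (Measure.pi fun _ : Fin m => D) {S | ENNReal.ofReal L ≤ ∫⁻ h, F (S, h) ∂P} :=
          lintegral_indicator_one (measurableSet_le measurable_const hFS)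
      _ ≤ (∫⁻ S, ∫⁻ h, F (S, h) ∂P ∂(Measure.pi fun _ : Fin m => D)) / ENNReal.ofReal L :=
          meas_ge_le_lintegral_div hFS.aemeasurable (by simpa using hL0) ENNReal.ofReal_ne_top
      _ ≤ ENNReal.ofReal (2 * √m) / ENNReal.ofReal L := by gcongr
      _ = ENNReal.ofReal δ := by
          rw [← ENNReal.ofReal_div_of_pos hL0, hL]
          have := Real.sqrt_pos.2 hm0
          congr 1
          field_simp
  have hB₂ : ν B₂ ≤ ENNReal.ofReal δ' := by
    rw [hνapply _ hB₂meas]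
    calc _ ≤ ∫⁻ _ : Fin m → Z, ENNReal.ofReal δ' ∂(Measure.pi fun _ : Fin m => D) := by
          refine lintegral_mono fun S => ?_
          refine (pi_not_binKL_le (κ S) (hrSsec S) (hrS01 S) hn b).trans
            (ENNReal.ofReal_le_ofReal ?_)
          have : (n : ℝ) * b = Real.log (2 / δ') := by rw [hb]; field_simp
          rw [this, Real.exp_neg, Real.exp_log (by positivity), inv_div]
          linarith
      _ = _ := by simp
  have hgood : (B₁ ∪ B₂)ᶜ ⊆ {p : (Fin m → Z) × (Fin n → H) |
      riskDQ ℓ D (κ p.1) ≤ klInv (klInv ((1 / (n : ℝ)) * ∑ i, riskS ℓ p.1 (p.2 i))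
        (ENNReal.ofReal b)) ((klDiv' (κ p.1) P + ENNReal.ofReal (Real.log L)) / (m : ℝ≥0∞))} := by
    rintro ⟨S, W⟩ hx
    rw [Set.compl_union] at hx
    have h1 : ∫⁻ h, expKL m (riskS ℓ S h) (riskD ℓ D h) ∂P ≤ ENNReal.ofReal L :=
      (lt_of_not_ge fun h => hx.1 h).le
    have h2 := not_not.1 hx.2
    have hmc : riskSQ ℓ S (κ S) ≤ klInv (avg (S, W)) (ENNReal.ofReal b) :=
      le_klInv (havg01 _).1 (havg01 _).2
        (h2.imp_right fun h => ⟨h.1, ENNReal.ofReal_le_ofReal h.2⟩)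
    exact (integral_le_klInv_of_lintegral_expKL_le (Q := κ S) (hrSsec S) hrD (hrS01 S) hrD01
      hm hL0 h1).trans (klInv_mono _ (integral_mem_Icc (hrSsec S) (hrS01 S)).1 hmc
        (klInv_le_one (havg01 _).2 _))
  refine le_trans ?_ (measure_mono hgood)
  rw [prob_compl_eq_one_sub (hB₁meas.union hB₂meas), sub_sub,
    ENNReal.ofReal_sub _ (by positivity), ENNReal.ofReal_one, ENNReal.ofReal_add hδ0.le hδ'0.le]
  exact tsub_le_tsub_left ((measure_union_le _ _).trans (add_le_add hB₁ hB₂)) _
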